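/- Let P be a finite poset and M a set of maximal elements of P (possibly not all of them). If the inclusion of the subcomplex ⋃_{m∈M} ΔP_{<m} into ΔP_{∉M} is null-homotopic, then ΔP ≃ ΔP_{∉M} ∨ ⋁_{m∈M} Σ ΔP_{<m}. -/

import Mathlib

/-- The geometric realization of the order complex of the subposet of `P` induced on `S`:
functions `P → ℝ` that are nonnegative, finitely supported, sum to `1`, and whose support is
a chain contained in `S`. Simplices are exactly the finite chains of `S`. -/
def ocSet (P : Type) [Preorder P] (S : Set P) : Set (P → ℝ) :=
  {f | (∀ x, 0 ≤ f x) ∧ (Function.support f).Finite ∧ (∑ᶠ x, f x) = 1 ∧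
    Function.support f ⊆ S ∧ IsChain (· ≤ ·) (Function.support f)}

/-- The order complex `Δ S` of the subposet induced on `S`, as a topological space. -/
abbrev ΔSp {P : Type} [Preorder P] (S : Set P) : Type := ↥(ocSet P S)

lemma ocSet_mono {P : Type} [Preorder P] {S T : Set P} (h : S ⊆ T) :
    ocSet P S ⊆ ocSet P T :=
  fun _ hf => ⟨hf.1, hf.2.1, hf.2.2.1, hf.2.2.2.1.trans h, hf.2.2.2.2⟩

/-- The inclusion of order complexes induced by `S ⊆ T`. -/
def ΔIncl {P : Type} [Preorder P] {S T : Set P} (h : S ⊆ T) : C(ΔSp S, ΔSp T) :=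
  ⟨Set.inclusion (ocSet_mono h), continuous_inclusion (ocSet_mono h)⟩
/-- The topological join `X * Y`: the double mapping cylinder of `X ← X × I × Y → Y`
(so that `X * ∅ = X` and `∅ * Y = Y`). -/
abbrev TopJoin (X Y : Type) [TopologicalSpace X] [TopologicalSpace Y] : Type :=
  Quot (fun a b : (X ⊕ (X × unitInterval × Y)) ⊕ Y =>
    (∃ x y, a = Sum.inl (Sum.inr (x, 0, y)) ∧ b = Sum.inl (Sum.inl x)) ∨
    (∃ x y, a = Sum.inl (Sum.inr (x, 1, y)) ∧ b = Sum.inr y))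

/-- The (unreduced) suspension `Σ X = S⁰ * X`. -/
abbrev Susp (X : Type) [TopologicalSpace X] : Type := TopJoin Bool X

/-- The wedge (one-point union) of two pointed spaces. -/
abbrev Wedge (X Y : Type) [TopologicalSpace X] [TopologicalSpace Y] (x0 : X) (y0 : Y) : Type :=
  Quot (fun a b : X ⊕ Y => a = Sum.inl x0 ∧ b = Sum.inr y0)

/-- The wedge of a family of pointed spaces (with an auxiliary base point glued to all the
base points of the family, so that the empty wedge is a one-point space). -/
abbrev BigWedge {ι : Type} (X : ι → Type) [∀ i, TopologicalSpace (X i)] (pt : ∀ i, X i) : Type :=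
  Quot (fun a b : (Σ i, X i) ⊕ Unit => (∃ i, a = Sum.inl ⟨i, pt i⟩) ∧ b = Sum.inr ())

/-- The base point of a wedge of a family. -/
def BigWedge.base {ι : Type} {X : ι → Type} [∀ i, TopologicalSpace (X i)] {pt : ∀ i, X i} :
    BigWedge X pt :=
  Quot.mk _ (Sum.inr ())

open scoped unitInterval

/-- The relation gluing the bottoms of the cylinders `A i × I` to `X` along the maps `f i` and
collapsing each of their tops to a point. -/
inductive MultiConeRel {ι : Type} {A : ι → Type} {X : Type} [∀ i, TopologicalSpace (A i)]
    [TopologicalSpace X] (f : ∀ i, C(A i, X)) :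
    X ⊕ (Σ i, (A i × I) ⊕ Unit) → X ⊕ (Σ i, (A i × I) ⊕ Unit) → Prop
  | bottom (i : ι) (a : A i) : MultiConeRel f (Sum.inr ⟨i, Sum.inl (a, 0)⟩) (Sum.inl (f i a))
  | top (i : ι) (a : A i) :
      MultiConeRel f (Sum.inr ⟨i, Sum.inl (a, 1)⟩) (Sum.inr ⟨i, Sum.inr ()⟩)

/-- The mapping cone of a family of maps `f i : A i → X`, with one apex for each index. -/
abbrev MultiCone {ι : Type} {A : ι → Type} {X : Type} [∀ i, TopologicalSpace (A i)]
    [TopologicalSpace X] (f : ∀ i, C(A i, X)) : Type :=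
  Quot (MultiConeRel f)

namespace MultiCone

variable {ι : Type} {A : ι → Type} {X Z : Type} [∀ i, TopologicalSpace (A i)]
  [TopologicalSpace X] [TopologicalSpace Z]

/-- The inclusion of the base space. -/
def base (f : ∀ i, C(A i, X)) : C(X, MultiCone f) :=
  ⟨fun x => Quot.mk _ (Sum.inl x), continuous_quot_mk.comp continuous_inl⟩

/-- The `i`-th cylinder. -/
def cyl (f : ∀ i, C(A i, X)) (i : ι) : C(A i × I, MultiCone f) :=
  ⟨fun p => Quot.mk _ (Sum.inr ⟨i, Sum.inl p⟩),
    continuous_quot_mk.comp (continuous_inr.comp (continuous_sigmaMk.comp continuous_inl))⟩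

/-- The `i`-th apex. -/
def apex (f : ∀ i, C(A i, X)) (i : ι) : MultiCone f :=
  Quot.mk _ (Sum.inr ⟨i, Sum.inr ()⟩)

lemma cyl_zero (f : ∀ i, C(A i, X)) (i : ι) (a : A i) : cyl f i (a, 0) = base f (f i a) :=
  Quot.sound (.bottom i a)

lemma cyl_one (f : ∀ i, C(A i, X)) (i : ι) (a : A i) : cyl f i (a, 1) = apex f i :=
  Quot.sound (.top i a)

lemma induction {f : ∀ i, C(A i, X)} {p : MultiCone f → Prop} (hb : ∀ x, p (base f x))
    (hc : ∀ i a t, p (cyl f i (a, t))) (ha : ∀ i, p (apex f i)) (z : MultiCone f) : p z := by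
  rcases z with ⟨x | ⟨i, ⟨a, t⟩ | ⟨⟩⟩⟩
  exacts [hb x, hc i a t, ha i]

/-- Maps out of the mapping cone. -/
def desc (f : ∀ i, C(A i, X)) (u : C(X, Z)) (v : ∀ i, C(A i × I, Z)) (w : ι → Z)
    (h0 : ∀ i a, v i (a, 0) = u (f i a)) (h1 : ∀ i a, v i (a, 1) = w i) :
    C(MultiCone f, Z) where
  toFun := Quot.lift
    (Sum.elim u fun s : Σ i, (A i × I) ⊕ Unit => Sum.elim (v s.1) (fun _ => w s.1) s.2) (by
      rintro _ _ (⟨i, a⟩ | ⟨i, a⟩)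
      exacts [h0 i a, h1 i a])
  continuous_toFun := continuous_quot_lift _ <| u.continuous.sumElim <|
    continuous_sigma fun i => show Continuous (Sum.elim (v i) fun _ => w i) from
      (v i).continuous.sumElim continuous_const

section desc

variable (f : ∀ i, C(A i, X)) (u : C(X, Z)) (v : ∀ i, C(A i × I, Z)) (w : ι → Z)
    (h0 : ∀ i a, v i (a, 0) = u (f i a)) (h1 : ∀ i a, v i (a, 1) = w i)

@[simp] lemma desc_base (x : X) : desc f u v w h0 h1 (base f x) = u x := rfl

@[simp] lemma desc_cyl (i : ι) (p : A i × I) : desc f u v w h0 h1 (cyl f i p) = v i p := rfl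

@[simp] lemma desc_apex (i : ι) : desc f u v w h0 h1 (apex f i) = w i := rfl

end desc

/-- Two maps out of a mapping cone that agree on the base and at the apexes are homotopic as soon
as they are joined by homotopies on the cylinders fixing the bottom and the top. -/
lemma homotopic_of_cyl {f : ∀ i, C(A i, X)} {φ ψ : C(MultiCone f, Z)}
    (K : ∀ i, C((A i × I) × I, Z))
    (hb : ∀ x, φ (base f x) = ψ (base f x)) (ha : ∀ i, φ (apex f i) = ψ (apex f i))
    (hφ : ∀ i p, K i (p, 0) = φ (cyl f i p)) (hψ : ∀ i p, K i (p, 1) = ψ (cyl f i p))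
    (h0 : ∀ i a s, K i ((a, 0), s) = φ (base f (f i a)))
    (h1 : ∀ i a s, K i ((a, 1), s) = φ (apex f i)) : φ.Homotopic ψ := by
  let L : C(MultiCone f, C(I, Z)) := desc f
    (ContinuousMap.curry ⟨fun p : X × I => φ (base f p.1), by fun_prop⟩)
    (fun i => (K i).curry) (fun i => .const I (φ (apex f i)))
    (fun i a => by ext s; exact h0 i a s) (fun i a => by ext s; exact h1 i a s)
  refine ⟨⟨⟨fun p => L p.2 p.1, by fun_prop⟩, fun z => ?_, fun z => ?_⟩⟩
  · induction z using MultiCone.induction with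
    | hb x => rfl
    | hc i a t => exact hφ i (a, t)
    | ha i => rfl
  · induction z using MultiCone.induction with
    | hb x => exact hb x
    | hc i a t => exact hψ i (a, t)
    | ha i => exact ha i

/-- The `i`-th cylinder prolonged below its bottom by a homotopy starting at `f i`. -/
noncomputable def stretch (f : ∀ i, C(A i, X)) (i : ι) {k : C(A i, X)} (H : (f i).Homotopy k) :
    C(A i × ℝ, MultiCone f) where
  toFun p := if p.2 ≤ 0 then base f (H (Set.projIcc 0 1 zero_le_one (-p.2), p.1))
    else cyl f i (p.1, Set.projIcc 0 1 zero_le_one p.2)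
  continuous_toFun := by
    refine Continuous.if_le ?_ ?_ continuous_snd continuous_const ?_
    · fun_prop
    · fun_prop
    · rintro ⟨a, t⟩ (rfl : t = 0)
      simp [cyl_zero]

section stretch

variable (f : ∀ i, C(A i, X)) (i : ι) {k : C(A i, X)} (H : (f i).Homotopy k) (a : A i)

lemma stretch_of_nonpos {t : ℝ} (ht : t ≤ 0) :
    stretch f i H (a, t) = base f (H (Set.projIcc 0 1 zero_le_one (-t), a)) :=
  if_pos ht

lemma stretch_of_nonneg {t : ℝ} (ht : 0 ≤ t) :
    stretch f i H (a, t) = cyl f i (a, Set.projIcc 0 1 zero_le_one t) := by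
  rcases ht.eq_or_lt with rfl | ht
  · simp [stretch_of_nonpos, cyl_zero]
  · exact if_neg ht.not_ge

lemma stretch_coe (t : I) : stretch f i H (a, (t : ℝ)) = cyl f i (a, t) := by
  rw [stretch_of_nonneg _ _ _ _ t.2.1, Set.projIcc_val]

lemma stretch_zero : stretch f i H (a, 0) = base f (f i a) := by
  simpa [cyl_zero] using stretch_coe f i H a 0

lemma stretch_one : stretch f i H (a, 1) = apex f i := by
  simpa [cyl_one] using stretch_coe f i H a 1

lemma stretch_neg_one : stretch f i H (a, -1) = base f (k a) := by
  simp [stretch_of_nonpos]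

end stretch

/-- The map of mapping cones induced by homotopies of the attaching maps. -/
noncomputable def transport {f g : ∀ i, C(A i, X)} (H : ∀ i, (f i).Homotopy (g i)) :
    C(MultiCone f, MultiCone g) :=
  desc f (base g)
    (fun i => ⟨fun p => stretch g i (H i).symm (p.1, 2 * (p.2 : ℝ) - 1), by fun_prop⟩) (apex g)
    (fun i a => by simp [stretch_neg_one])
    (fun i a => by
      have : (2 : ℝ) - 1 = 1 := by norm_num
      simp [this, stretch_one])

lemma transport_stretch {f g : ∀ i, C(A i, X)} (H : ∀ i, (f i).Homotopy (g i)) (i : ι) (a : A i)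
    (t : I) : transport (fun i => (H i).symm) (stretch g i (H i).symm (a, 2 * (t : ℝ) - 1)) =
      stretch f i (H i) (a, max (-2 * (t : ℝ)) (4 * t - 3)) := by
  obtain ⟨t, ht0, ht1⟩ := t
  rcases le_total t (1 / 2) with h | h
  · rw [stretch_of_nonpos _ _ _ _ (by dsimp; linarith), max_eq_left (by dsimp; linarith),
      stretch_of_nonpos _ _ _ _ (by dsimp; linarith)]
    simp only [transport, desc_base, ContinuousMap.Homotopy.symm_apply]
    congr 3
    rw [Set.projIcc_of_mem _ ⟨by linarith, by linarith⟩,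
      Set.projIcc_of_mem _ ⟨by linarith, by linarith⟩]
    ext
    simp
  · rw [stretch_of_nonneg _ _ _ _ (by dsimp; linarith), max_eq_right (by dsimp; linarith),
      Set.projIcc_of_mem _ ⟨by linarith, by linarith⟩]
    simp only [transport, desc_cyl, ContinuousMap.coe_mk, ContinuousMap.Homotopy.symm_symm]
    congr 2
    ring

lemma transport_comp_transport {f g : ∀ i, C(A i, X)} (H : ∀ i, (f i).Homotopy (g i)) :
    ((transport fun i => (H i).symm).comp (transport H)).Homotopic (.id _) := by
  refine homotopic_of_cyl
    (fun i => ⟨fun q => stretch f i (H i) (q.1.1, (1 - (q.2 : ℝ)) *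
      max (-2 * (q.1.2 : ℝ)) (4 * q.1.2 - 3) + q.2 * q.1.2), by fun_prop⟩)
    (fun x => rfl) (fun i => rfl) ?_ ?_ ?_ ?_
  · rintro i ⟨a, t⟩
    simpa [transport] using (transport_stretch H i a t).symm
  · rintro i ⟨a, t⟩
    simpa using stretch_coe f i (H i) a t
  · intro i a s
    simpa [transport] using stretch_zero f i (H i) a
  · intro i a s
    have : max (-2 : ℝ) (4 - 3) = 1 := by norm_num
    simpa [this, transport] using stretch_one f i (H i) a

/-- Homotopic families of maps have homotopy equivalent mapping cones. -/
noncomputable def homotopyEquiv {f g : ∀ i, C(A i, X)} (H : ∀ i, (f i).Homotopy (g i)) :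
    ContinuousMap.HomotopyEquiv (MultiCone f) (MultiCone g) where
  toFun := transport H
  invFun := transport fun i => (H i).symm
  left_inv := transport_comp_transport H
  right_inv := by simpa using transport_comp_transport fun i => (H i).symm

end MultiCone

namespace TopSusp

variable {A Z : Type} [TopologicalSpace A] [TopologicalSpace Z]

/-- The two poles of a suspension. -/
def pole (b : Bool) : Susp A := Quot.mk _ (Sum.inl (Sum.inl b))

/-- The equator of a suspension. -/
def equator : C(A, Susp A) :=
  ⟨fun a => Quot.mk _ (Sum.inr a), continuous_quot_mk.comp continuous_inr⟩

/-- The hemispheres of a suspension, parametrized from the pole to the equator. -/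
def hemisphere : C(Bool × I × A, Susp A) :=
  ⟨fun p => Quot.mk _ (Sum.inl (Sum.inr p)),
    continuous_quot_mk.comp (continuous_inl.comp continuous_inr)⟩

lemma hemisphere_zero (b : Bool) (a : A) : hemisphere (b, 0, a) = pole b :=
  Quot.sound (.inl ⟨b, a, rfl, rfl⟩)

lemma hemisphere_one (b : Bool) (a : A) : hemisphere (b, 1, a) = equator a :=
  Quot.sound (.inr ⟨b, a, rfl, rfl⟩)

lemma induction {p : Susp A → Prop} (hp : ∀ b, p (pole b)) (hh : ∀ b t a, p (hemisphere (b, t, a)))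
    (z : Susp A) : p z := by
  rcases z with ⟨(b | ⟨b, t, a⟩) | a⟩
  · exact hp b
  · exact hh b t a
  · have := hh true 1 a
    rwa [hemisphere_one] at this

/-- The height of a point of a hemisphere over the pole `false`, where the pole `true` has
height `1`. -/
noncomputable def height : C(Bool × I, I) where
  toFun p := Set.projIcc 0 1 zero_le_one
    ((if p.1 then 1 else 0 : ℝ) + (if p.1 then -1 else 1 : ℝ) * (p.2 / 2))
  continuous_toFun := by
    have h (u : Bool → ℝ) : Continuous fun p : Bool × I => u p.1 :=
      continuous_of_discreteTopology.comp continuous_fst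
    exact continuous_projIcc.comp <| (h fun b => if b then 1 else 0).add <|
      (h fun b => if b then -1 else 1).mul (by fun_prop)

lemma height_false (t : I) : (height (false, t) : ℝ) = t / 2 := by
  have := t.2.1
  have := t.2.2
  have h : (t : ℝ) / 2 ∈ Set.Icc (0 : ℝ) 1 := ⟨by linarith, by linarith⟩
  simp [height, Set.projIcc_of_mem _ h]

lemma height_true (t : I) : (height (true, t) : ℝ) = 1 - t / 2 := by
  have := t.2.1
  have := t.2.2
  have h : 1 + -((t : ℝ) / 2) ∈ Set.Icc (0 : ℝ) 1 := ⟨by linarith, by linarith⟩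
  simp only [height, ContinuousMap.coe_mk, if_true, neg_one_mul, Set.projIcc_of_mem _ h]
  ring

/-- The point of the suspension at a given height over the pole `false`. -/
noncomputable def atHeight : C(A × I, Susp A) where
  toFun p := if (p.2 : ℝ) ≤ 1 / 2 then
      hemisphere (false, Set.projIcc 0 1 zero_le_one (2 * (p.2 : ℝ)), p.1)
    else hemisphere (true, Set.projIcc 0 1 zero_le_one (2 - 2 * (p.2 : ℝ)), p.1)
  continuous_toFun := by
    refine Continuous.if_le ?_ ?_ (by fun_prop) continuous_const ?_
    · fun_prop
    · fun_prop
    · rintro ⟨a, t⟩ h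
      have h2 : (2 : ℝ) - 1 = 1 := by norm_num
      simp only at h
      simp [h, h2, hemisphere_one]

lemma atHeight_zero (a : A) : atHeight (a, 0) = pole false := by
  simp [atHeight, hemisphere_zero]

lemma atHeight_one (a : A) : atHeight (a, 1) = pole true := by
  have h : ¬ (1 : ℝ) ≤ 2⁻¹ := by norm_num
  simp [atHeight, hemisphere_zero, h]

lemma atHeight_height (b : Bool) (t : I) (a : A) :
    atHeight (a, height (b, t)) = hemisphere (b, t, a) := by
  have h0 := t.2.1
  have h1 := t.2.2
  cases b
  · have h : (t : ℝ) / 2 ≤ 1 / 2 := by linarith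
    have e : 2 * ((t : ℝ) / 2) = t := by ring
    simp only [atHeight, ContinuousMap.coe_mk, height_false, if_pos h, e, Set.projIcc_val]
  · have e : 2 - 2 * (1 - (t : ℝ) / 2) = t := by ring
    rcases h1.eq_or_lt with h | h
    · obtain rfl : t = 1 := Subtype.ext h
      have h2 : (1 : ℝ) - 1 / 2 ≤ 1 / 2 := by norm_num
      have e2 : 2 * ((1 : ℝ) - 1 / 2) = 1 := by norm_num
      simp only [atHeight, ContinuousMap.coe_mk, height_true, Set.Icc.coe_one, if_pos h2, e2]
      simp [hemisphere_one]
    · have h2 : ¬ (1 - (t : ℝ) / 2 ≤ 1 / 2) := by linarith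
      simp only [atHeight, ContinuousMap.coe_mk, height_true, if_neg h2, e, Set.projIcc_val]

/-- Maps out of the suspension given by maps out of the cylinder constant on top and bottom. -/
noncomputable def desc (v : C(A × I, Z)) (w : Bool → Z) (h0 : ∀ a, v (a, 0) = w false)
    (h1 : ∀ a, v (a, 1) = w true) : C(Susp A, Z) where
  toFun := Quot.lift
    (Sum.elim (Sum.elim w fun p => v (p.2.2, height (p.1, p.2.1)))
      fun a => v (a, height (false, 1))) (by
      rintro _ _ (⟨b, a, rfl, rfl⟩ | ⟨b, a, rfl, rfl⟩)
      · cases b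
        · have : height (false, 0) = 0 := by ext; simp [height_false]
          simpa [this] using h0 a
        · have : height (true, 0) = 1 := by ext; simp [height_true]
          simpa [this] using h1 a
      · cases b
        · rfl
        · have : height (true, 1) = height (false, 1) := by
            ext; simp only [height_true, height_false, Set.Icc.coe_one]; norm_num
          simp [this])
  continuous_toFun := continuous_quot_lift _ <|
    (continuous_of_discreteTopology.sumElim (by fun_prop)).sumElim (by fun_prop)

section desc

variable (v : C(A × I, Z)) (w : Bool → Z) (h0 : ∀ a, v (a, 0) = w false)
    (h1 : ∀ a, v (a, 1) = w true)

lemma desc_hemisphere (b : Bool) (t : I) (a : A) :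
    desc v w h0 h1 (hemisphere (b, t, a)) = v (a, height (b, t)) := rfl

lemma desc_atHeight (a : A) (t : I) : desc v w h0 h1 (atHeight (a, t)) = v (a, t) := by
  have h0 := t.2.1
  have h1 := t.2.2
  by_cases h : (t : ℝ) ≤ 1 / 2
  · simp only [atHeight, ContinuousMap.coe_mk, if_pos h, desc_hemisphere]
    congr 2
    ext
    rw [height_false, Set.projIcc_of_mem _ ⟨by linarith, by linarith⟩]
    simp
  · simp only [atHeight, ContinuousMap.coe_mk, if_neg h, desc_hemisphere]
    push Not at h
    congr 2
    ext
    rw [height_true, Set.projIcc_of_mem _ ⟨by linarith, by linarith⟩]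
    simp only
    ring

end desc

end TopSusp

namespace MultiCone

variable {ι : Type} {A : ι → Type} {X : Type} [∀ i, TopologicalSpace (A i)]
  [TopologicalSpace X]

/-- The wedge of `X` with the suspensions of the spaces `A i`. -/
abbrev WedgeSusp (A : ι → Type) [∀ i, TopologicalSpace (A i)] (x : X) : Type :=
  Wedge X (BigWedge (fun i => Susp (A i)) fun _ => TopSusp.pole false) x BigWedge.base

/-- The inclusion of `X` in its wedge with suspensions. -/
def wedgeBase (A : ι → Type) [∀ i, TopologicalSpace (A i)] (x : X) : C(X, WedgeSusp A x) :=
  ⟨fun y => Quot.mk _ (Sum.inl y), continuous_quot_mk.comp continuous_inl⟩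

/-- The inclusion of a suspension in the wedge. -/
def wedgeSusp (A : ι → Type) [∀ i, TopologicalSpace (A i)] (x : X) (i : ι) :
    C(Susp (A i), WedgeSusp A x) :=
  ⟨fun s => Quot.mk _ (Sum.inr (Quot.mk _ (Sum.inl ⟨i, s⟩))),
    continuous_quot_mk.comp <| continuous_inr.comp <| continuous_quot_mk.comp <|
      continuous_inl.comp continuous_sigmaMk⟩

lemma wedgeSusp_pole (x : X) (i : ι) :
    wedgeSusp A x i (TopSusp.pole false) = wedgeBase A x x := by
  have h : (Quot.mk _ (Sum.inl ⟨i, TopSusp.pole false⟩) :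
      BigWedge (fun i => Susp (A i)) fun _ => TopSusp.pole false) = BigWedge.base :=
    Quot.sound ⟨⟨i, rfl⟩, rfl⟩
  refine (congrArg (fun z => (Quot.mk _ (Sum.inr z) : WedgeSusp A x)) h).trans ?_
  symm
  exact Quot.sound ⟨rfl, rfl⟩

/-- The comparison map from the mapping cone of constant maps to the wedge of suspensions. -/
noncomputable def toWedge (x : X) :
    C(MultiCone fun i => ContinuousMap.const (A i) x, WedgeSusp A x) :=
  desc _ (wedgeBase A x) (fun i => (wedgeSusp A x i).comp TopSusp.atHeight)
    (fun i => wedgeSusp A x i (TopSusp.pole true))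
    (fun i a => by simp [TopSusp.atHeight_zero, wedgeSusp_pole])
    (fun i a => by simp [TopSusp.atHeight_one])

/-- The map from a suspension to the mapping cone of constant maps. -/
noncomputable def ofSusp (x : X) (i : ι) :
    C(Susp (A i), MultiCone fun i => ContinuousMap.const (A i) x) :=
  TopSusp.desc (cyl _ i) (fun b => bif b then apex _ i else base _ x)
    (fun a => cyl_zero _ i a) (fun a => cyl_one _ i a)

/-- The inverse of `toWedge`. -/
noncomputable def ofWedge (x : X) :
    C(WedgeSusp A x, MultiCone fun i => ContinuousMap.const (A i) x) where
  toFun := Quot.lift (Sum.elim (base _)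
    (Quot.lift (Sum.elim (fun s : Σ i, Susp (A i) => ofSusp x s.1 s.2) fun _ => base _ x)
      (by rintro _ _ ⟨⟨i, rfl⟩, rfl⟩; rfl))) (by rintro _ _ ⟨rfl, rfl⟩; rfl)
  continuous_toFun := continuous_quot_lift _ <| (base _).continuous.sumElim <|
    continuous_quot_lift _ <| (continuous_sigma fun i => (ofSusp x i).continuous).sumElim
      continuous_const

/-- The mapping cone of constant maps is a wedge of suspensions. -/
noncomputable def constHomeomorph (x : X) :
    MultiCone (fun i => ContinuousMap.const (A i) x) ≃ₜ WedgeSusp A x where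
  toFun := toWedge x
  invFun := ofWedge x
  left_inv z := by
    induction z using MultiCone.induction with
    | hb y => rfl
    | hc i a t =>
      change ofSusp x i (TopSusp.atHeight (a, t)) = cyl _ i (a, t)
      exact TopSusp.desc_atHeight ..
    | ha i => rfl
  right_inv z := by
    rcases z with ⟨y | ⟨⟨i, s⟩ | ⟨⟩⟩⟩
    · rfl
    · change toWedge x (ofSusp x i s) = wedgeSusp A x i s
      induction s using TopSusp.induction with
      | hp b =>
        cases b
        · exact (wedgeSusp_pole x i).symm
        · rfl
      | hh b t a => exact congrArg (wedgeSusp A x i) (TopSusp.atHeight_height b t a)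
    · exact Quot.sound ⟨rfl, rfl⟩

end MultiCone

section OrderComplex

variable {P : Type}

section Preorder

variable [Preorder P]

lemma mem_ocSet_iff [Fintype P] {S : Set P} {f : P → ℝ} :
    f ∈ ocSet P S ↔ f ∈ stdSimplex ℝ P ∧ (∀ x, f x ≠ 0 → x ∈ S) ∧
      ∀ x y, f x ≠ 0 → f y ≠ 0 → x ≤ y ∨ y ≤ x := by
  rw [ocSet, Set.mem_ofPred_eq, finsum_eq_sum_of_fintype]
  constructor
  · rintro ⟨h0, -, h1, hS, hc⟩
    exact ⟨⟨h0, h1⟩, fun x hx => hS hx, fun x y hx hy => hc.total hx hy⟩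
  · rintro ⟨⟨h0, h1⟩, hS, hc⟩
    exact ⟨h0, Set.toFinite _, h1, fun x hx => hS x hx, fun x hx y hy _ => hc x y hx hy⟩

lemma isCompact_ocSet [Finite P] (S : Set P) : IsCompact (ocSet P S) := by
  have := Fintype.ofFinite P
  have h : ocSet P S = stdSimplex ℝ P ∩ ((⋂ x ∈ Sᶜ, {f : P → ℝ | f x = 0}) ∩
      ⋂ (x) (y) (_ : ¬ (x ≤ y ∨ y ≤ x)), {f : P → ℝ | f x * f y = 0}) := by
    ext f
    simp only [mem_ocSet_iff, Set.mem_inter_iff, Set.mem_iInter, Set.mem_ofPred_eq, Set.mem_compl_iff,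
      mul_eq_zero]
    refine and_congr_right fun _ => and_congr (forall_congr' fun x => ?_)
      (forall_congr' fun x => forall_congr' fun y => ?_) <;> tauto
  rw [h]
  refine (isCompact_stdSimplex ℝ P).inter_right (IsClosed.inter ?_ ?_)
  · exact isClosed_biInter fun x _ => isClosed_eq (continuous_apply x) continuous_const
  · exact isClosed_iInter fun x => isClosed_iInter fun y => isClosed_iInter fun _ =>
      isClosed_eq ((continuous_apply x).mul (continuous_apply y)) continuous_const

instance [Finite P] (S : Set P) : CompactSpace (ΔSp S) :=
  isCompact_iff_compactSpace.mp (isCompact_ocSet S)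

lemma ocSet_apply_eq_zero {S : Set P} {f : P → ℝ} (hf : f ∈ ocSet P S) {x : P} (hx : x ∉ S) :
    f x = 0 := by
  by_contra h
  exact hx (hf.2.2.2.1 h)

lemma ocSet_apply_le_one [Finite P] {S : Set P} {f : P → ℝ} (hf : f ∈ ocSet P S) (x : P) :
    f x ≤ 1 := by
  have := Fintype.ofFinite P
  have h := (mem_ocSet_iff.1 hf).1
  exact h.2 ▸ Finset.single_le_sum (fun y _ => h.1 y) (Finset.mem_univ x)

end Preorder

open Classical in
/-- The point dividing the segment from `a` to the vertex `m` in the ratio `t : 1 - t`. -/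
noncomputable def conePoint (m : P) (a : P → ℝ) (t : ℝ) : P → ℝ :=
  fun x => (1 - t) * a x + t * if x = m then 1 else 0

lemma conePoint_self (m : P) {a : P → ℝ} (ha : a m = 0) (t : ℝ) : conePoint m a t m = t := by
  simp [conePoint, ha]

lemma conePoint_of_ne {m x : P} (h : x ≠ m) (a : P → ℝ) (t : ℝ) :
    conePoint m a t x = (1 - t) * a x := by
  simp [conePoint, h]

lemma conePoint_zero (m : P) (a : P → ℝ) : conePoint m a 0 = a := by
  ext x; simp [conePoint]

variable [PartialOrder P]

lemma conePoint_mem [Finite P] {m : P} {a : P → ℝ} {t : ℝ} (ht : t ∈ Set.Icc (0 : ℝ) 1)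
    (ha : a ∈ ocSet P (Set.Iio m)) : conePoint m a t ∈ ocSet P Set.univ := by
  classical
  have := Fintype.ofFinite P
  obtain ⟨⟨h0, h1⟩, hS, hc⟩ := mem_ocSet_iff.1 ha
  have hne : ∀ x, conePoint m a t x ≠ 0 → x = m ∨ a x ≠ 0 := by
    intro x hx
    by_contra! h
    exact hx (by simp [conePoint, h.1, h.2])
  refine mem_ocSet_iff.2 ⟨⟨fun x => ?_, ?_⟩, fun _ _ => trivial, fun x y hx hy => ?_⟩
  · have := mul_nonneg (sub_nonneg.2 ht.2) (h0 x)
    have := ht.1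
    unfold conePoint
    split_ifs <;> linarith
  · simp only [conePoint, Finset.sum_add_distrib, ← Finset.mul_sum, h1, Finset.sum_ite_eq',
      Finset.mem_univ, if_true]
    ring
  · rcases hne x hx with rfl | hx <;> rcases hne y hy with rfl | hy
    · exact .inl le_rfl
    · exact .inr (le_of_lt (hS y hy))
    · exact .inl (le_of_lt (hS x ‹_›))
    · exact hc x y hx hy

open Classical in
lemma vertex_mem [Finite P] (m : P) :
    (fun x => if x = m then 1 else 0 : P → ℝ) ∈ ocSet P Set.univ := by
  have := Fintype.ofFinite P
  refine mem_ocSet_iff.2 ⟨⟨fun x => ?_, by simp⟩, fun _ _ => trivial, fun x y hx hy => ?_⟩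
  · dsimp only
    split_ifs <;> norm_num
  · simp only [ne_eq, ite_eq_right_iff, one_ne_zero, imp_false, not_not] at hx hy
    exact .inl (hx.trans hy.symm).le

open Classical in
lemma eq_vertex [Finite P] {S : Set P} {g : P → ℝ} (hg : g ∈ ocSet P S) {m : P} (h : g m = 1) :
    g = fun x => if x = m then 1 else 0 := by
  have := Fintype.ofFinite P
  obtain ⟨⟨h0, h1⟩, -⟩ := mem_ocSet_iff.1 hg
  rw [← Finset.add_sum_erase _ _ (Finset.mem_univ m), h, add_eq_left,
    Finset.sum_eq_zero_iff_of_nonneg fun x _ => h0 x] at h1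
  ext x
  split_ifs with hx
  · rw [hx, h]
  · exact h1 x (Finset.mem_erase.2 ⟨hx, Finset.mem_univ x⟩)

lemma exists_conePoint_eq [Finite P] {g : P → ℝ} (hg : g ∈ ocSet P Set.univ) {m : P}
    (hm : ∀ x, ¬ m < x) (h0 : g m ≠ 0) (h1 : g m ≠ 1) :
    ∃ a ∈ ocSet P (Set.Iio m), conePoint m a (g m) = g := by
  classical
  have := Fintype.ofFinite P
  have h1' : 0 < 1 - g m := sub_pos.2 ((ocSet_apply_le_one hg m).lt_of_ne h1)
  obtain ⟨⟨hg0, hg1⟩, -, hc⟩ := mem_ocSet_iff.1 hg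
  have hsupp : ∀ x, (if x = m then 0 else g x / (1 - g m)) ≠ 0 → x ≠ m ∧ g x ≠ 0 := by
    intro x hx
    split_ifs at hx with h
    · exact absurd rfl hx
    · exact ⟨h, fun h' => hx (by simp [h'])⟩
  refine ⟨fun x => if x = m then 0 else g x / (1 - g m), mem_ocSet_iff.2
    ⟨⟨fun x => ?_, ?_⟩, fun x hx => ?_, fun x y hx hy => hc x y (hsupp x hx).2 (hsupp y hy).2⟩, ?_⟩
  · dsimp only
    split_ifs
    · exact le_rfl
    · exact div_nonneg (hg0 x) h1'.le
  · rw [← Finset.add_sum_erase _ _ (Finset.mem_univ m)] at hg1 ⊢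
    rw [if_pos rfl, zero_add, Finset.sum_congr rfl fun x hx => if_neg (Finset.ne_of_mem_erase hx),
      ← Finset.sum_div, div_eq_one_iff_eq h1'.ne']
    linarith
  · obtain ⟨hne, hx⟩ := hsupp x hx
    rcases hc x m hx h0 with h | h
    · exact lt_of_le_of_ne h hne
    · exact absurd (lt_of_le_of_ne h hne.symm) (hm x)
  · ext x
    by_cases h : x = m
    · simp [conePoint, h]
    · rw [conePoint_of_ne h, if_neg h, mul_div_cancel₀ _ h1'.ne']

/-- The map collapsing the mapping cone of the inclusions of `ΔP_{<m}`, for `m ∈ M`, to `ΔP`: the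
apex of index `m` goes to the vertex `m`. -/
noncomputable def coneToΔ [Finite P] {M : Set P} (hM : ∀ m : M, Set.Iio (m : P) ⊆ Mᶜ) :
    C(MultiCone fun m : M => ΔIncl (hM m), ΔSp (Set.univ : Set P)) :=
  open Classical in
  MultiCone.desc _ (ΔIncl (Set.subset_univ _))
    (fun m => ⟨fun p => ⟨conePoint (m : P) p.1 p.2, conePoint_mem p.2.2 p.1.2⟩,
      Continuous.subtype_mk (continuous_pi fun x => by
        have : Continuous fun p : ΔSp (Set.Iio (m : P)) × I => p.1.1 x :=
          (continuous_apply x).comp (continuous_subtype_val.comp continuous_fst)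
        unfold conePoint
        fun_prop) _⟩)
    (fun m => ⟨_, vertex_mem (m : P)⟩)
    (fun m a => Subtype.ext (conePoint_zero _ _))
    (fun m a => Subtype.ext (by ext x; simp [conePoint]))

section coneToΔ

variable [Finite P] {M : Set P} (hM : ∀ m : M, Set.Iio (m : P) ⊆ Mᶜ)

lemma coneToΔ_base (x : ΔSp Mᶜ) : (coneToΔ hM (MultiCone.base _ x)).1 = x.1 := rfl

lemma coneToΔ_cyl (m : M) (a : ΔSp (Set.Iio (m : P))) (t : I) :
    (coneToΔ hM (MultiCone.cyl _ m (a, t))).1 = conePoint (m : P) a.1 t := rfl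

open Classical in
lemma coneToΔ_apex (m : M) :
    (coneToΔ hM (MultiCone.apex _ m)).1 = fun x => if x = (m : P) then 1 else 0 := rfl

lemma coneToΔ_base_apply (x : ΔSp Mᶜ) (m : M) : (coneToΔ hM (MultiCone.base _ x)).1 m = 0 :=
  ocSet_apply_eq_zero x.2 (by simp)

lemma coneToΔ_cyl_self (m : M) (a : ΔSp (Set.Iio (m : P))) (t : I) :
    (coneToΔ hM (MultiCone.cyl _ m (a, t))).1 m = t :=
  conePoint_self _ (ocSet_apply_eq_zero a.2 (by simp)) _

lemma coneToΔ_cyl_of_ne {m m' : M} (h : m' ≠ m) (a : ΔSp (Set.Iio (m : P))) (t : I) :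
    (coneToΔ hM (MultiCone.cyl _ m (a, t))).1 m' = 0 := by
  rw [coneToΔ_cyl, conePoint_of_ne (fun h' => h (Subtype.ext h')),
    ocSet_apply_eq_zero a.2 (fun h' => hM m h' m'.2), mul_zero]

lemma coneToΔ_apex_self (m : M) : (coneToΔ hM (MultiCone.apex _ m)).1 m = 1 := by
  simp [coneToΔ_apex]

lemma coneToΔ_apex_of_ne {m m' : M} (h : m' ≠ m) :
    (coneToΔ hM (MultiCone.apex _ m)).1 m' = 0 := by
  simp [coneToΔ_apex, Subtype.coe_inj, h]

lemma exists_eq_base_of_coneToΔ (z : MultiCone fun m : M => ΔIncl (hM m))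
    (hz : ∀ m : M, (coneToΔ hM z).1 m = 0) : ∃ x, z = MultiCone.base _ x := by
  induction z using MultiCone.induction with
  | hb x => exact ⟨x, rfl⟩
  | hc m a t =>
    have := hz m
    rw [coneToΔ_cyl_self] at this
    obtain rfl : t = 0 := Subtype.ext this
    exact ⟨_, MultiCone.cyl_zero (fun m : M => ΔIncl (hM m)) m a⟩
  | ha m => exact absurd (hz m) (by simp [coneToΔ_apex_self])

lemma exists_eq_cyl_of_coneToΔ (z : MultiCone fun m : M => ΔIncl (hM m)) {m : M}
    (h0 : (coneToΔ hM z).1 m ≠ 0) (h1 : (coneToΔ hM z).1 m ≠ 1) :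
    ∃ p, z = MultiCone.cyl _ m p := by
  induction z using MultiCone.induction with
  | hb x => exact absurd (coneToΔ_base_apply hM x m) h0
  | hc m' a t =>
    by_cases h : m = m'
    · subst h
      exact ⟨_, rfl⟩
    · exact absurd (coneToΔ_cyl_of_ne hM h a t) h0
  | ha m' =>
    by_cases h : m = m'
    · subst h
      exact absurd (coneToΔ_apex_self hM m) h1
    · exact absurd (coneToΔ_apex_of_ne hM h) h0

lemma eq_apex_of_coneToΔ (z : MultiCone fun m : M => ΔIncl (hM m)) {m : M}
    (h1 : (coneToΔ hM z).1 m = 1) : z = MultiCone.apex _ m := by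
  induction z using MultiCone.induction with
  | hb x => simp [coneToΔ_base_apply hM x m] at h1
  | hc m' a t =>
    by_cases h : m = m'
    · subst h
      rw [coneToΔ_cyl_self] at h1
      obtain rfl : t = 1 := Subtype.ext h1
      exact MultiCone.cyl_one (fun m : M => ΔIncl (hM m)) m a
    · simp [coneToΔ_cyl_of_ne hM h a t] at h1
  | ha m' =>
    by_cases h : m = m'
    · rw [h]
    · simp [coneToΔ_apex_of_ne hM h] at h1

lemma coneToΔ_injective : Function.Injective (coneToΔ hM) := by
  intro z z' h
  by_cases hz : ∀ m : M, (coneToΔ hM z).1 m = 0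
  · obtain ⟨x, rfl⟩ := exists_eq_base_of_coneToΔ hM z hz
    obtain ⟨x', rfl⟩ := exists_eq_base_of_coneToΔ hM z' (h ▸ hz)
    have := congrArg Subtype.val h
    rw [coneToΔ_base, coneToΔ_base] at this
    rw [Subtype.ext this]
  push Not at hz
  obtain ⟨m, h0⟩ := hz
  by_cases h1 : (coneToΔ hM z).1 m = 1
  · rw [eq_apex_of_coneToΔ hM z h1, eq_apex_of_coneToΔ hM z' (h ▸ h1)]
  · obtain ⟨⟨a', t'⟩, rfl⟩ := exists_eq_cyl_of_coneToΔ hM z' (h ▸ h0) (h ▸ h1)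
    obtain ⟨⟨a, t⟩, rfl⟩ := exists_eq_cyl_of_coneToΔ hM z h0 h1
    have hv := congrArg Subtype.val h
    have ht := congrFun hv m
    rw [coneToΔ_cyl_self, coneToΔ_cyl_self] at ht
    obtain rfl : t = t' := Subtype.ext ht
    rw [coneToΔ_cyl_self] at h1
    rw [coneToΔ_cyl, coneToΔ_cyl] at hv
    have ha : a = a' := by
      ext x
      have := congrFun hv x
      rw [conePoint, conePoint, add_left_inj] at this
      exact mul_left_cancel₀ (sub_ne_zero.2 (Ne.symm h1)) this
    rw [ha]

lemma coneToΔ_surjective (hmax : ∀ m ∈ M, ∀ x : P, ¬ m < x) :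
    Function.Surjective (coneToΔ hM) := by
  intro g
  by_cases hz : ∀ m : M, g.1 m = 0
  · obtain ⟨h0, hf, h1, -, hc⟩ := g.2
    exact ⟨MultiCone.base _ ⟨g.1, h0, hf, h1, fun x hx hxM => hx (hz ⟨x, hxM⟩), hc⟩, rfl⟩
  push Not at hz
  obtain ⟨m, h0⟩ := hz
  by_cases h1 : g.1 m = 1
  · exact ⟨MultiCone.apex _ m, Subtype.ext (eq_vertex g.2 h1).symm⟩
  · obtain ⟨a, ha, hg⟩ := exists_conePoint_eq g.2 (hmax m m.2) h0 h1
    exact ⟨MultiCone.cyl _ m (⟨a, ha⟩, ⟨g.1 m, g.2.1 m, ocSet_apply_le_one g.2 m⟩),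
      Subtype.ext hg⟩

/-- The order complex of `P` is the mapping cone of the inclusions of `ΔP_{<m}`, for `m ∈ M`. -/
noncomputable def coneHomeomorphΔ (hmax : ∀ m ∈ M, ∀ x : P, ¬ m < x) :
    (MultiCone fun m : M => ΔIncl (hM m)) ≃ₜ ΔSp (Set.univ : Set P) :=
  Continuous.homeoOfEquivCompactToT2
    (f := Equiv.ofBijective _ ⟨coneToΔ_injective hM, coneToΔ_surjective hM hmax⟩)
    (coneToΔ hM).continuous

end coneToΔ

end OrderComplex

/-- **Lemma `rubanok`.** Let `P` be a finite poset and `M` a set of maximal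
elements of `P` (possibly not all of them). If the inclusion of the subcomplex
`⋃_{m ∈ M} ΔP_{<m}` into `ΔP_{∉M}` is null-homotopic, then
`ΔP ≃ ΔP_{∉M} ∨ ⋁_{m ∈ M} Σ ΔP_{<m}`. -/
theorem orderComplex_homotopyEquiv_wedge_of_maximals
    (P : Type) [PartialOrder P] [Finite P] (M : Set P)
    (hmax : ∀ m ∈ M, ∀ x : P, ¬ m < x)
    (hsub : (⋃ m ∈ M, ocSet P (Set.Iio m)) ⊆ ocSet P Mᶜ)
    (hnull : ContinuousMap.Nullhomotopic
      (⟨Set.inclusion hsub, continuous_inclusion hsub⟩ :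
        C(↥(⋃ m ∈ M, ocSet P (Set.Iio m)), ΔSp (Mᶜ : Set P)))) :
    ∃ (x0 : ΔSp (Mᶜ : Set P)) (pt : ∀ m : M, Susp (ΔSp (Set.Iio (m : P)))),
      Nonempty (ContinuousMap.HomotopyEquiv (ΔSp (Set.univ : Set P))
        (Wedge (ΔSp (Mᶜ : Set P))
          (BigWedge (fun m : M => Susp (ΔSp (Set.Iio (m : P)))) pt)
          x0 BigWedge.base)) := by
  have hM (m : M) : Set.Iio (m : P) ⊆ Mᶜ := fun x hx hxM => hmax x hxM m hx
  obtain ⟨x0, h⟩ := hnull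
  have H (m : M) : (ΔIncl (hM m)).Homotopic (.const _ x0) := by
    let j : C(ΔSp (Set.Iio (m : P)), ↥(⋃ m ∈ M, ocSet P (Set.Iio m))) :=
      ⟨fun a => ⟨a.1, Set.mem_biUnion m.2 a.2⟩, by fun_prop⟩
    exact h.comp (.refl j)
  refine ⟨x0, fun _ => TopSusp.pole false, ⟨?_⟩⟩
  exact ((coneHomeomorphΔ hM hmax).symm.toHomotopyEquiv.trans
    (MultiCone.homotopyEquiv fun m => (H m).some)).trans
    (MultiCone.constHomeomorph x0).toHomotopyEquiv
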